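/- Let α be a Radon probability measure on ℝ^n with finite first moment and let p ∈ [1,∞]. Then there exists a point z in the support of α with ‖m(α) − z‖ ≤ diam_p(α), where m(α) = ∫_{ℝ^n} x α(dx) is the Euclidean mean of α. -/

import Mathlib

open MeasureTheory ENNReal NNReal

noncomputable section

namespace Paper

variable {X Y : Type*}

/-- The (topological) support of a measure: points all of whose open neighborhoods
have positive measure. -/
def msupport [TopologicalSpace X] [MeasurableSpace X] (α : Measure X) : Set X :=
  {x | ∀ U : Set X, IsOpen U → x ∈ U → 0 < α U}

/-- The `p`-diameter of a measure, `p ∈ [1,∞]`.  For `p = ∞` it is the diameter of the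
support; for finite `p` it is `(∬ d(x,x')^p dα dα)^{1/p}`. -/
def pDiam [PseudoEMetricSpace X] [MeasurableSpace X] (p : ℝ≥0∞) (α : Measure X) : ℝ≥0∞ :=
  if p = ∞ then EMetric.diam (msupport α)
  else (∫⁻ x, ∫⁻ y, edist x y ^ p.toReal ∂α ∂α) ^ (1 / p.toReal)

/-- The `p`-radius of a measure, `p ∈ [1,∞]`.  For `p = ∞` it is the radius of the
support; for finite `p` it is `inf_x (∫ d(x,x')^p dα)^{1/p}`. -/
def pRad [PseudoEMetricSpace X] [MeasurableSpace X] (p : ℝ≥0∞) (α : Measure X) : ℝ≥0∞ :=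
  if p = ∞ then ⨅ x : X, ⨆ a ∈ msupport α, edist x a
  else ⨅ x : X, (∫⁻ y, edist x y ^ p.toReal ∂α) ^ (1 / p.toReal)

/-- Couplings between two measures: measures on the product with the given marginals. -/
def Coupling [MeasurableSpace X] (α β : Measure X) : Set (Measure (X × X)) :=
  {μ | μ.map Prod.fst = α ∧ μ.map Prod.snd = β}

/-- The `q`-Wasserstein distance, `q ∈ [1,∞]`. -/
def wDist [PseudoEMetricSpace X] [MeasurableSpace X] (q : ℝ≥0∞) (α β : Measure X) : ℝ≥0∞ :=
  if q = ∞ then ⨅ μ ∈ Coupling α β, ⨆ z ∈ msupport μ, edist z.1 z.2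
  else ⨅ μ ∈ Coupling α β, (∫⁻ z, edist z.1 z.2 ^ q.toReal ∂μ) ^ (1 / q.toReal)

/-- The distortion `sup |d(x,x') - d(f x, f x')|` of a map between (pseudo e)metric spaces. -/
def distortion [PseudoEMetricSpace X] [PseudoEMetricSpace Y] (f : X → Y) : ℝ≥0∞ :=
  ⨆ x : X, ⨆ x' : X,
    max (edist x x' - edist (f x) (f x')) (edist (f x) (f x') - edist x x')

/-- The codistortion `sup_{x,y} |d_X(x, ψ y) - d_Y(φ x, y)|` of a pair of maps. -/
def codistortion [PseudoEMetricSpace X] [PseudoEMetricSpace Y] (φ : X → Y) (ψ : Y → X) :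
    ℝ≥0∞ :=
  ⨆ x : X, ⨆ y : Y,
    max (edist x (ψ y) - edist (φ x) y) (edist (φ x) y - edist x (ψ y))

/-- Gromov--Hausdorff distance, via the distortion/codistortion formula. -/
def ghDist (X Y : Type*) [PseudoEMetricSpace X] [PseudoEMetricSpace Y] : ℝ≥0∞ :=
  (1 / 2 : ℝ≥0∞) *
    ⨅ φ : X → Y, ⨅ ψ : Y → X,
      max (distortion φ) (max (distortion ψ) (codistortion φ ψ))

/-- The invariant `i_{q,p}(α) = (∫ d_{W,q}(α, δ_x)^p dα(x))^{1/p}`. -/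
def iInv [PseudoEMetricSpace X] [MeasurableSpace X] (q p : ℝ≥0∞) (α : Measure X) : ℝ≥0∞ :=
  if p = ∞ then ⨆ x ∈ msupport α, wDist q α (Measure.dirac x)
  else (∫⁻ x, wDist q α (Measure.dirac x) ^ p.toReal ∂α) ^ (1 / p.toReal)

/-- Dirac delta as a probability measure. -/
def diracPM [MeasurableSpace X] (x : X) : ProbabilityMeasure X :=
  ⟨Measure.dirac x, inferInstance⟩

/-- Finitely supported probability measures. -/
def finPM (X : Type*) [TopologicalSpace X] [MeasurableSpace X] : Set (ProbabilityMeasure X) :=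
  {α | (msupport α.toMeasure).Finite}

/-- The `p`-Vietoris--Rips metric thickening at scale `r`, as a subset of the space of
probability measures with the weak topology. -/
def VRm (p : ℝ≥0∞) (X : Type*) [PseudoEMetricSpace X] [MeasurableSpace X] (r : ℝ≥0∞) :
    Set (ProbabilityMeasure X) :=
  {α | pDiam p α.toMeasure < r}

/-- The `p`-Čech metric thickening at scale `r`. -/
def Cechm (p : ℝ≥0∞) (X : Type*) [PseudoEMetricSpace X] [MeasurableSpace X] (r : ℝ≥0∞) :
    Set (ProbabilityMeasure X) :=
  {α | pRad p α.toMeasure < r}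

/-- Finitely supported version of the `p`-Vietoris--Rips thickening. -/
def VRmFin (p : ℝ≥0∞) (X : Type*) [PseudoEMetricSpace X] [MeasurableSpace X] (r : ℝ≥0∞) :
    Set (ProbabilityMeasure X) :=
  VRm p X r ∩ finPM X

/-- Finitely supported version of the `p`-Čech thickening. -/
def CechmFin (p : ℝ≥0∞) (X : Type*) [PseudoEMetricSpace X] [MeasurableSpace X] (r : ℝ≥0∞) :
    Set (ProbabilityMeasure X) :=
  Cechm p X r ∩ finPM X


/-- Convex combination `(1-t)·α + t·β` of probability measures. -/
def lincomb [MeasurableSpace X] (t : ℝ) (h0 : 0 ≤ t) (h1 : t ≤ 1)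
    (α β : ProbabilityMeasure X) : ProbabilityMeasure X :=
  ⟨ENNReal.ofReal (1 - t) • α.toMeasure + ENNReal.ofReal t • β.toMeasure, by
    constructor
    simp only [Measure.coe_add, Pi.add_apply, Measure.smul_apply, smul_eq_mul,
      measure_univ, mul_one]
    rw [← ENNReal.ofReal_add (by linarith) h0]
    norm_num⟩

/-- A `δ`-map between spaces-with-functions. -/
def IsDeltaMap {A B : Type*} [TopologicalSpace A] [TopologicalSpace B]
    (φA : A → ℝ) (φB : B → ℝ) (δ : ℝ) (F : A → B) : Prop :=
  Continuous F ∧ ∀ a, φB (F a) ≤ φA a + δ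

/-- `δ`-homotopy between two `δ`-maps. -/
def DeltaHomotopic {A B : Type*} [TopologicalSpace A] [TopologicalSpace B]
    (φA : A → ℝ) (φB : B → ℝ) (δ : ℝ) (F₀ F₁ : A → B) : Prop :=
  ∃ H : A × unitInterval → B, Continuous H ∧
    (∀ a, H (a, 0) = F₀ a) ∧ (∀ a, H (a, 1) = F₁ a) ∧
    ∀ t : unitInterval, IsDeltaMap φA φB δ (fun a => H (a, t))

/-- `δ`-homotopy equivalence between two spaces-with-functions. -/
def DeltaHomotopyEquiv {A B : Type*} [TopologicalSpace A] [TopologicalSpace B]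
    (δ : ℝ) (φA : A → ℝ) (φB : B → ℝ) : Prop :=
  ∃ F : A → B, ∃ G : B → A,
    IsDeltaMap φA φB δ F ∧ IsDeltaMap φB φA δ G ∧
    DeltaHomotopic φA φA (2 * δ) (G ∘ F) id ∧
    DeltaHomotopic φB φB (2 * δ) (F ∘ G) id

/-- The homotopy type distance `d_HT`. -/
def dHT {A B : Type*} [TopologicalSpace A] [TopologicalSpace B]
    (φA : A → ℝ) (φB : B → ℝ) : ℝ≥0∞ :=
  sInf {e : ℝ≥0∞ | ∃ δ : ℝ, 0 ≤ δ ∧ DeltaHomotopyEquiv δ φA φB ∧ e = ENNReal.ofReal δ}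

/-- The `p`-spread of a metric space. -/
def pSpread (p : ℝ≥0∞) (X : Type*) [PseudoEMetricSpace X] [MeasurableSpace X] : ℝ≥0∞ :=
  ⨅ αs ∈ finPM X, ⨆ α : ProbabilityMeasure X,
    wDist p (αs : ProbabilityMeasure X).toMeasure α.toMeasure

/-- The medial axis of a subset `X` of a normed space. -/
def medialAxis {E : Type*} [NormedAddCommGroup E] (X : Set E) : Set E :=
  closure {y | ∃ x₁ ∈ X, ∃ x₂ ∈ X, x₁ ≠ x₂ ∧
    dist y x₁ = Metric.infDist y X ∧ dist y x₂ = Metric.infDist y X}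

/-- The reach of a subset `X`: the distance from `X` to its medial axis. -/
def reach {E : Type*} [NormedAddCommGroup E] (X : Set E) : ℝ≥0∞ :=
  ⨅ x ∈ X, ⨅ y ∈ medialAxis X, edist x y

/-- `p`-radius with the infimum restricted to a subset `X` of the ambient space. -/
def pRadIn {E : Type*} [PseudoEMetricSpace E] [MeasurableSpace E] (p : ℝ≥0∞)
    (X : Set E) (α : Measure E) : ℝ≥0∞ :=
  ⨅ x ∈ X, (∫⁻ y, edist x y ^ p.toReal ∂α) ^ (1 / p.toReal)


lemma msupport_eq_support [TopologicalSpace X] [MeasurableSpace X] (α : Measure X) :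
    msupport α = α.support := by
  ext x
  rw [Measure.mem_support_iff_forall]
  refine ⟨fun h U hU => ?_, fun h U hU hx => h U (hU.mem_nhds hx)⟩
  obtain ⟨V, hVU, hV, hx⟩ := mem_nhds_iff.1 hU
  exact (h V hV hx).trans_le (measure_mono hVU)

lemma ae_mem_msupport [TopologicalSpace X] [HereditarilyLindelofSpace X] [MeasurableSpace X]
    (α : Measure X) : ∀ᵐ x ∂α, x ∈ msupport α := by
  rw [msupport_eq_support]
  exact Measure.support_mem_ae

/-- Jensen's inequality for the distance to a fixed point. -/
lemma edist_integral_le_lintegral_edist {E : Type*} [NormedAddCommGroup E] [NormedSpace ℝ E]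
    [CompleteSpace E] [MeasurableSpace E] (α : Measure E) [IsProbabilityMeasure α]
    (h : Integrable (fun x : E => x) α) (z : E) :
    edist (∫ x, x ∂α) z ≤ ∫⁻ x, edist z x ∂α := by
  have hz : (∫ x, x ∂α) - z = ∫ x, (x - z) ∂α := by
    rw [integral_sub h (integrable_const z)]
    simp
  simp_rw [edist_comm z, edist_eq_enorm_sub, hz]
  exact enorm_integral_le_lintegral_enorm _

/-- Monotonicity of power means of the distance to a fixed point. -/
lemma lintegral_edist_le_rpow {E : Type*} [NormedAddCommGroup E] [MeasurableSpace E]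
    (α : Measure E) [IsProbabilityMeasure α] (h : AEStronglyMeasurable (fun x : E => x) α)
    (z : E) {q : ℝ} (hq : 1 ≤ q) :
    ∫⁻ x, edist z x ∂α ≤ (∫⁻ x, edist z x ^ q ∂α) ^ (1 / q) := by
  have hm : AEStronglyMeasurable (fun x : E => z - x) α := aestronglyMeasurable_const.sub h
  simpa [eLpNorm', edist_eq_enorm_sub] using
    eLpNorm'_le_eLpNorm'_of_exponent_le one_pos hq α hm

/-- For a Radon probability measure `α` on `ℝ^n` with finite first moment
and `p ∈ [1,∞]`, there is a point `z` in the support of `α` with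
`‖m(α) − z‖ ≤ diam_p(α)`, where `m(α) = ∫ x dα` is the Euclidean mean. -/
theorem exists_support_point_near_mean {n : ℕ}
    (α : Measure (EuclideanSpace ℝ (Fin n))) [IsProbabilityMeasure α] (hα : α.InnerRegular)
    (hmom : Integrable (fun x : EuclideanSpace ℝ (Fin n) => x) α)
    (p : ℝ≥0∞) (hp : 1 ≤ p) :
    ∃ z ∈ msupport α, edist (∫ x, x ∂α) z ≤ pDiam p α := by
  by_cases hp_top : p = ∞
  · obtain ⟨z, hz⟩ := (ae_mem_msupport α).exists
    refine ⟨z, hz, (edist_integral_le_lintegral_edist α hmom z).trans ?_⟩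
    rw [pDiam, if_pos hp_top]
    calc ∫⁻ x, edist z x ∂α ≤ ∫⁻ _, Metric.ediam (msupport α) ∂α :=
          lintegral_mono_ae <| (ae_mem_msupport α).mono fun x hx =>
            Metric.edist_le_ediam_of_mem hz hx
      _ = Metric.ediam (msupport α) := by simp
  · have hq : 1 ≤ p.toReal := by
      simpa using ENNReal.toReal_mono hp_top hp
    have hmeas : Measurable fun x : EuclideanSpace ℝ (Fin n) =>
        ∫⁻ y, edist x y ^ p.toReal ∂α :=
      (measurable_edist.pow_const _).lintegral_prod_right'
    obtain ⟨z, hz, hle⟩ := exists_notMem_null_le_lintegral hmeas.aemeasurable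
      (ae_iff.1 (ae_mem_msupport α))
    refine ⟨z, not_not.1 hz, (edist_integral_le_lintegral_edist α hmom z).trans <|
      (lintegral_edist_le_rpow α hmom.aestronglyMeasurable z hq).trans ?_⟩
    rw [pDiam, if_neg hp_top]
    exact ENNReal.rpow_le_rpow hle (by positivity)

end Paper
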